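/- arXiv:1305.1072 — 2 statements merged into one kernel-verified Lean document; each statement's English description precedes it below -/
import Mathlib

section
/- Let α > 1 be a real number and let F be a family of finite simple graphs such that F contains no complete graph (i.e., ω̲(F) = 0), and suppose the property P = Her(F) is infinite. Then λ^(α)(P) = lim_{n→∞} λ^(α)(P,n)·n^{(2/α)−2} = 1. -/
open Filter

/-- A family of finite simple graphs, given by the set of its members of each order `n`
(a member of order `n` is a graph on the vertex set `Fin n`). -/
abbrev GraphFamily := ∀ n : ℕ, Set (SimpleGraph (Fin n))

/-- A family of graphs is hereditary if it is closed under taking induced subgraphs. -/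
def IsHereditary (P : GraphFamily) : Prop :=
  ∀ ⦃m n : ℕ⦄ (f : Fin m ↪ Fin n) ⦃G : SimpleGraph (Fin n)⦄,
    G ∈ P n → G.comap f ∈ P m

/-- The number of edges of a graph. -/
noncomputable def edgeCount {n : ℕ} (G : SimpleGraph (Fin n)) : ℕ :=
  G.edgeSet.ncard

/-- `exP P n` is the maximum number of edges of a graph of order `n` belonging to `P`. -/
noncomputable def exP (P : GraphFamily) (n : ℕ) : ℕ :=
  sSup {m | ∃ G ∈ P n, edgeCount G = m}

open Classical in
/-- `quadSum G x = 2 * ∑_{{u,v} ∈ E(G)} x_u * x_v`. -/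
noncomputable def quadSum {n : ℕ} (G : SimpleGraph (Fin n)) (x : Fin n → ℝ) : ℝ :=
  ∑ u, ∑ v, if G.Adj u v then x u * x v else 0

/-- `λ^(α)(G)`: the maximum of `2∑_{{u,v}∈E(G)} x_u x_v` over real vectors `x`
with `∑ |x_i|^α = 1`. -/
noncomputable def lambdaA (α : ℝ) {n : ℕ} (G : SimpleGraph (Fin n)) : ℝ :=
  sSup {y | ∃ x : Fin n → ℝ, (∑ i, |x i| ^ α) = 1 ∧ y = quadSum G x}

/-- `λ^(α)(P, n)`: the maximum of `λ^(α)(G)` over graphs `G` of order `n` in `P`. -/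
noncomputable def lambdaP (α : ℝ) (P : GraphFamily) (n : ℕ) : ℝ :=
  sSup {y | ∃ G ∈ P n, y = lambdaA α G}

/-- `H` is isomorphic to an induced subgraph of `G`. -/
def IsInducedSubgraph {V W : Type*} (H : SimpleGraph V) (G : SimpleGraph W) : Prop :=
  ∃ f : V ↪ W, ∀ u v, G.Adj (f u) (f v) ↔ H.Adj u v

/-- `H` is isomorphic to a (not necessarily induced) subgraph of `G`. -/
def IsSubgraphOf {V W : Type*} (H : SimpleGraph V) (G : SimpleGraph W) : Prop :=
  ∃ f : V ↪ W, ∀ u v, H.Adj u v → G.Adj (f u) (f v)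

/-- `Her F`: the family of all graphs containing no member of `F` (of order ≥ 1)
as an induced subgraph. -/
def Her (F : GraphFamily) : GraphFamily :=
  fun _ => {G | ∀ m, 1 ≤ m → ∀ H ∈ F m, ¬ IsInducedSubgraph H G}

/-- A family of graphs is infinite iff it contains graphs of infinitely many orders
(each order carries only finitely many graphs). -/
def FamInfinite (P : GraphFamily) : Prop := {n | (P n).Nonempty}.Infinite

/-- `G` is a complete `r`-partite graph: its vertex set splits into `r` nonempty
independent parts, with all edges present between distinct parts. -/
def IsCompletePartite (r : ℕ) {n : ℕ} (G : SimpleGraph (Fin n)) : Prop :=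
  ∃ c : Fin n → Fin r, Function.Surjective c ∧ ∀ u v, G.Adj u v ↔ c u ≠ c v

/-- `ω̲(F)`: the least `r ≥ 1` with `K_r ∈ F`, or `0` (`= sInf ∅`) if `F` contains
no complete graph. -/
noncomputable def omegaLow (F : GraphFamily) : ℕ :=
  sInf {r | 1 ≤ r ∧ (⊤ : SimpleGraph (Fin r)) ∈ F r}

/-- `β(F)`: the least `r ≥ 1` such that `F` contains a complete `r`-partite graph,
or `0` (`= sInf ∅`) if `F` contains no complete multipartite graph. -/
noncomputable def betaF (F : GraphFamily) : ℕ :=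
  sInf {r | 1 ≤ r ∧ ∃ n, ∃ G ∈ F n, IsCompletePartite r G}

/-- `Her F` contains every complete graph when `F` contains none. -/
lemma top_mem_Her {F : GraphFamily}
    (hω : ∀ r : ℕ, 1 ≤ r → (⊤ : SimpleGraph (Fin r)) ∉ F r) (n : ℕ) :
    (⊤ : SimpleGraph (Fin n)) ∈ Her F n := by
  rintro m hm H hH ⟨f, hf⟩
  have hH_top : H = ⊤ := by
    ext u v
    rw [← hf u v]
    simp
  exact hω m hm (hH_top ▸ hH)

lemma quadSum_le_sq_sum_abs {n : ℕ} (G : SimpleGraph (Fin n)) (x : Fin n → ℝ) :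
    quadSum G x ≤ (∑ i, |x i|) ^ 2 := by
  classical
  rw [quadSum, sq, Finset.sum_mul_sum]
  refine Finset.sum_le_sum fun u _ => Finset.sum_le_sum fun v _ => ?_
  split_ifs
  · exact (le_abs_self _).trans (abs_mul _ _).le
  · positivity

/-- The power mean inequality bounds the quadratic form on the unit sphere of `ℓ^α`. -/
lemma quadSum_le {α : ℝ} (hα : 1 < α) {n : ℕ} (G : SimpleGraph (Fin n)) {x : Fin n → ℝ}
    (hx : ∑ i, |x i| ^ α = 1) : quadSum G x ≤ (n : ℝ) ^ (2 - 2 / α) := by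
  have hα0 : 0 < α := by linarith
  have hpow : (∑ i, |x i|) ^ α ≤ (n : ℝ) ^ (α - 1) := by
    simpa [hx] using Real.rpow_sum_le_const_mul_sum_rpow Finset.univ x hα.le
  have hS : 0 ≤ ∑ i, |x i| := Finset.sum_nonneg fun i _ => abs_nonneg _
  calc quadSum G x ≤ (∑ i, |x i|) ^ 2 := quadSum_le_sq_sum_abs G x
    _ = ((∑ i, |x i|) ^ α) ^ (2 / α) := by
      rw [← Real.rpow_mul hS, mul_div_cancel₀ _ hα0.ne', Real.rpow_two]
    _ ≤ ((n : ℝ) ^ (α - 1)) ^ (2 / α) := by gcongr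
    _ = (n : ℝ) ^ (2 - 2 / α) := by
      rw [← Real.rpow_mul n.cast_nonneg]
      congr 1
      field_simp

lemma lambdaA_le {α : ℝ} (hα : 1 < α) {n : ℕ} (G : SimpleGraph (Fin n)) :
    lambdaA α G ≤ (n : ℝ) ^ (2 - 2 / α) := by
  refine Real.sSup_le ?_ (by positivity)
  rintro y ⟨x, hx, rfl⟩
  exact quadSum_le hα G hx

lemma lambdaP_le {α : ℝ} (hα : 1 < α) (P : GraphFamily) (n : ℕ) :
    lambdaP α P n ≤ (n : ℝ) ^ (2 - 2 / α) := by
  refine Real.sSup_le ?_ (by positivity)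
  rintro y ⟨G, -, rfl⟩
  exact lambdaA_le hα G

lemma lambdaA_le_lambdaP {α : ℝ} (hα : 1 < α) {P : GraphFamily} {n : ℕ}
    {G : SimpleGraph (Fin n)} (hG : G ∈ P n) : lambdaA α G ≤ lambdaP α P n := by
  refine le_csSup ⟨(n : ℝ) ^ (2 - 2 / α), ?_⟩ ⟨G, hG, rfl⟩
  rintro y ⟨G', -, rfl⟩
  exact lambdaA_le hα G'

lemma quadSum_top_const (n : ℕ) (c : ℝ) :
    quadSum (⊤ : SimpleGraph (Fin n)) (fun _ => c) = n * (n - 1) * c ^ 2 := by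
  classical
  have hrow (u : Fin n) :
      ∑ v, (if (⊤ : SimpleGraph (Fin n)).Adj u v then c * c else 0) = (n - 1) * c ^ 2 := by
    have hsplit (v : Fin n) : (if (⊤ : SimpleGraph (Fin n)).Adj u v then c * c else 0) =
        c * c - if u = v then c * c else 0 := by
      by_cases h : u = v <;> simp [h]
    simp only [hsplit, Finset.sum_sub_distrib, Finset.sum_ite_eq, Finset.mem_univ, if_true,
      Finset.sum_const, Finset.card_univ, Fintype.card_fin, nsmul_eq_mul]
    ring
  have hsum : quadSum (⊤ : SimpleGraph (Fin n)) (fun _ => c) =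
      ∑ _u : Fin n, ((n : ℝ) - 1) * c ^ 2 := by
    rw [← Finset.sum_congr rfl fun u _ => hrow u, quadSum]
    congr!
  rw [hsum, Finset.sum_const, Finset.card_univ, Fintype.card_fin, nsmul_eq_mul]
  ring

/-- The constant unit vector bounds `λ^(α)(K_n)` from below. -/
lemma le_lambdaA_top {α : ℝ} (hα : 1 < α) {n : ℕ} (hn : 0 < n) :
    (1 - 1 / (n : ℝ)) * (n : ℝ) ^ (2 - 2 / α) ≤ lambdaA α (⊤ : SimpleGraph (Fin n)) := by
  have hα0 : 0 < α := by linarith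
  have hn0 : (0 : ℝ) < n := Nat.cast_pos.2 hn
  refine le_csSup ⟨(n : ℝ) ^ (2 - 2 / α), ?_⟩ ⟨fun _ => (n : ℝ) ^ (-(1 / α)), ?_, ?_⟩
  · rintro y ⟨x, hx, rfl⟩
    exact quadSum_le hα _ hx
  · have hexp : -(1 / α) * α = -1 := by field_simp
    rw [Finset.sum_const, Finset.card_univ, Fintype.card_fin, nsmul_eq_mul,
      abs_of_nonneg (by positivity), ← Real.rpow_mul hn0.le, hexp, Real.rpow_neg_one,
      mul_inv_cancel₀ hn0.ne']
  · have hexp : 2 - 2 / α = 2 + -(1 / α) * 2 := by ring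
    rw [quadSum_top_const, hexp, Real.rpow_add hn0, Real.rpow_mul hn0.le, Real.rpow_two,
      Real.rpow_two]
    field_simp

/-- For `α > 1`, if `F` contains no complete graph (`ω̲(F) = 0`) and
`P = Her F` is infinite, then `λ^(α)(P) = lim_{n→∞} λ^(α)(P,n) ⬝ n^{2/α−2} = 1`. -/
theorem lambdaP_lim_eq_one (α : ℝ) (hα : 1 < α) (F : GraphFamily)
    (hω : ∀ r : ℕ, 1 ≤ r → (⊤ : SimpleGraph (Fin r)) ∉ F r)
    (hinf : FamInfinite (Her F)) :
    Tendsto (fun n : ℕ => lambdaP α (Her F) n * (n : ℝ) ^ (2 / α - 2)) atTop (nhds 1) := by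
  have hlim : Tendsto (fun n : ℕ => 1 - 1 / (n : ℝ)) atTop (nhds 1) := by
    simpa using tendsto_one_div_atTop_nhds_zero_nat.const_sub (1 : ℝ)
  have hcancel {n : ℕ} (hn : 0 < n) : (n : ℝ) ^ (2 - 2 / α) * (n : ℝ) ^ (2 / α - 2) = 1 := by
    rw [← Real.rpow_add (Nat.cast_pos.2 hn)]
    simp
  refine tendsto_of_tendsto_of_tendsto_of_le_of_le' hlim tendsto_const_nhds ?_ ?_
  · filter_upwards [eventually_gt_atTop 0] with n hn
    calc 1 - 1 / (n : ℝ)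
        = (1 - 1 / (n : ℝ)) * (n : ℝ) ^ (2 - 2 / α) * (n : ℝ) ^ (2 / α - 2) := by
          rw [mul_assoc, hcancel hn, mul_one]
      _ ≤ lambdaP α (Her F) n * (n : ℝ) ^ (2 / α - 2) := by
          gcongr
          exact (le_lambdaA_top hα hn).trans (lambdaA_le_lambdaP hα (top_mem_Her hω n))
  · filter_upwards [eventually_gt_atTop 0] with n hn
    rw [← hcancel hn]
    gcongr
    exact lambdaP_le hα _ n
end

section
/- Let α > 1 be a real number and let F be a family of finite simple graphs with ω̲(F) ≥ 2 and β(F) ≥ 2, and suppose the property P = Her(F) is infinite. Then λ^(α)(P) = lim_{n→∞} λ^(α)(P,n)·n^{(2/α)−2} = 1 − 1/(β(F) − 1). -/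
open Filter

/-- **Ramsey's theorem** for two colours, inside a finite set of vertices. -/
theorem SimpleGraph.exists_isNClique_or_isNIndepSet (a b : ℕ) :
    ∃ N : ℕ, ∀ {V : Type} (G : SimpleGraph V) (T : Finset V), N ≤ T.card →
      (∃ S ⊆ T, G.IsNClique a S) ∨ ∃ S ⊆ T, G.IsNIndepSet b S := by
  classical
  induction a generalizing b with
  | zero => exact ⟨0, fun G T _ => .inl ⟨∅, by simp, by simp [SimpleGraph.isNClique_iff]⟩⟩
  | succ a iha =>
    induction b with
    | zero => exact ⟨0, fun G T _ => .inr ⟨∅, by simp, by simp [SimpleGraph.isNIndepSet_iff]⟩⟩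
    | succ b ihb =>
      obtain ⟨N₁, h₁⟩ := iha (b + 1)
      obtain ⟨N₂, h₂⟩ := ihb
      refine ⟨N₁ + N₂ + 1, fun {V} G T hT => ?_⟩
      obtain ⟨v, hv⟩ : T.Nonempty := Finset.card_pos.1 (by omega)
      have hsub : ∀ (p : V → Prop) [DecidablePred p], (T.erase v).filter p ⊆ T := fun p _ =>
        (Finset.filter_subset _ _).trans (Finset.erase_subset _ _)
      have hcard := Finset.card_filter_add_card_filter_not (s := T.erase v) (fun w => G.Adj v w)
      rw [Finset.card_erase_of_mem hv] at hcard
      rcases le_or_gt N₁ ((T.erase v).filter (fun w => G.Adj v w)).card with h | h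
      · rcases h₁ G _ h with ⟨S, hS, hc⟩ | ⟨S, hS, hc⟩
        · refine .inl ⟨insert v S, Finset.insert_subset hv (hS.trans (hsub _)),
            hc.insert fun w hw => ?_⟩
          exact (Finset.mem_filter.1 (hS hw)).2
        · exact .inr ⟨S, hS.trans (hsub _), hc⟩
      · have h' : N₂ ≤ ((T.erase v).filter (fun w => ¬ G.Adj v w)).card := by omega
        rcases h₂ G _ h' with ⟨S, hS, hc⟩ | ⟨S, hS, hc⟩
        · exact .inl ⟨S, hS.trans (hsub _), hc⟩
        · refine .inr ⟨insert v S, Finset.insert_subset hv (hS.trans (hsub _)), ?_⟩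
          have hvS : v ∉ S := fun h => by simpa using hS h
          rw [SimpleGraph.isNIndepSet_iff] at hc ⊢
          refine ⟨?_, by rw [Finset.card_insert_of_notMem hvS, hc.2]⟩
          rw [SimpleGraph.isIndepSet_iff, Finset.coe_insert]
          refine hc.1.insert fun w hw _ => ?_
          have := (Finset.mem_filter.1 (hS hw)).2
          exact ⟨this, fun h => this h.symm⟩

theorem IsInducedSubgraph.trans {U V W : Type*} {K : SimpleGraph U} {H : SimpleGraph V}
    {G : SimpleGraph W} (h₁ : IsInducedSubgraph K H) (h₂ : IsInducedSubgraph H G) :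
    IsInducedSubgraph K G := by
  obtain ⟨f, hf⟩ := h₁
  obtain ⟨g, hg⟩ := h₂
  exact ⟨f.trans g, fun u v => by simp [hg, hf]⟩

theorem isHereditary_Her (F : GraphFamily) : IsHereditary (Her F) :=
  fun _ _ f _ hG k hk H hH hHG =>
    hG k hk H hH (hHG.trans ⟨f, fun _ _ => Iff.rfl⟩)

theorem cliqueFree_of_mem_Her {F : GraphFamily} (hω : omegaLow F ≠ 0) {n : ℕ}
    {G : SimpleGraph (Fin n)} (hG : G ∈ Her F n) : G.CliqueFree (omegaLow F) := by
  have hmem : omegaLow F ∈ {r | 1 ≤ r ∧ (⊤ : SimpleGraph (Fin r)) ∈ F r} :=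
    Nat.sInf_mem (Nat.nonempty_of_pos_sInf (Nat.pos_of_ne_zero hω))
  by_contra h
  rw [SimpleGraph.not_cliqueFree_iff_top_isContained] at h
  obtain ⟨f⟩ := h
  exact hG _ hmem.1 _ hmem.2 ⟨f.toEmbedding, fun u v =>
    ⟨fun h he => h.ne (congrArg _ he), fun h => f.toHom.map_adj h⟩⟩

theorem isInducedSubgraph_of_completeEquipartiteGraph_isContained {r m t n a : ℕ}
    {H : SimpleGraph (Fin m)} {c : Fin m → Fin r} (hc : ∀ u v, H.Adj u v ↔ c u ≠ c v)
    (ht : ∀ {V : Type} (G : SimpleGraph V) (T : Finset V), t ≤ T.card →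
      (∃ S ⊆ T, G.IsNClique a S) ∨ ∃ S ⊆ T, G.IsNIndepSet m S)
    {G : SimpleGraph (Fin n)} (hG : G.CliqueFree a)
    (hcon : (SimpleGraph.completeEquipartiteGraph r t).IsContained G) :
    IsInducedSubgraph H G := by
  classical
  obtain ⟨f⟩ := hcon
  have hind : ∀ i : Fin r, ∃ g : Fin m ↪ Fin t, ∀ x y, ¬ G.Adj (f (i, g x)) (f (i, g y)) := by
    intro i
    let K : SimpleGraph (Fin t) := G.comap fun j => f (i, j)
    have hinj : Function.Injective fun j => f (i, j) := fun x y hxy => by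
      simpa using f.injective hxy
    let e : K ↪g G := ⟨⟨_, hinj⟩, Iff.rfl⟩
    rcases ht K Finset.univ (by simp) with ⟨S, -, hS⟩ | ⟨S, -, hS⟩
    · exact absurd hS (hG.comap ⟨e.toCopy⟩ S)
    · rw [SimpleGraph.isNIndepSet_iff] at hS
      refine ⟨(S.orderEmbOfFin hS.2).toEmbedding, fun x y hxy => ?_⟩
      exact hS.1 (S.orderEmbOfFin_mem hS.2 x) (S.orderEmbOfFin_mem hS.2 y)
        (fun h => hxy.ne (by simp [h])) hxy
  choose g hg using hind
  have hadj : ∀ u v, G.Adj (f (c u, g (c u) u)) (f (c v, g (c v) v)) ↔ H.Adj u v := by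
    intro u v
    rw [hc]
    refine ⟨fun h he => ?_, fun h => f.toHom.map_adj h⟩
    rw [he] at h
    exact hg _ _ _ h
  refine ⟨⟨fun u => f (c u, g (c u) u), fun u v huv => ?_⟩, hadj⟩
  have h := Prod.ext_iff.1 (f.injective huv)
  have h2 := h.2
  simp only at h h2
  rw [h.1] at h2
  exact (g (c v)).injective h2

/-- In a large graph of `Her F` some vertex has degree below `(1 - 1 / (β(F) - 1) + ε) n`. -/
theorem eventually_exists_degree_lt {F : GraphFamily} (hω : omegaLow F ≠ 0) {r : ℕ}
    (hr : betaF F = r + 1) {ε : ℝ} (hε : 0 < ε) :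
    ∀ᶠ n in atTop, ∀ (G : SimpleGraph (Fin n)) [DecidableRel G.Adj], G ∈ Her F n →
      ∃ v, (G.degree v : ℝ) < (1 - 1 / r + ε) * n := by
  have hmem : betaF F ∈ {r | 1 ≤ r ∧ ∃ n, ∃ G ∈ F n, IsCompletePartite r G} :=
    Nat.sInf_mem (Nat.nonempty_of_pos_sInf (by unfold betaF at hr; omega))
  rw [hr] at hmem
  obtain ⟨-, m, H, hH, c, hsurj, hc⟩ := hmem
  have hm : 1 ≤ m := by
    have := Fintype.card_le_of_surjective c hsurj
    simp at this; omega
  obtain ⟨t, ht⟩ := SimpleGraph.exists_isNClique_or_isNIndepSet (omegaLow F) m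
  filter_upwards [SimpleGraph.eventually_completeEquipartiteGraph_isContained_of_minDegree hε r t,
    eventually_ge_atTop 1] with n hn hn1 G _ hG
  by_contra! hdeg
  have : Nonempty (Fin n) := ⟨⟨0, hn1⟩⟩
  obtain ⟨v, hv⟩ := G.exists_minimal_degree_vertex
  exact hG m hm H hH (isInducedSubgraph_of_completeEquipartiteGraph_isContained hc ht
    (cliqueFree_of_mem_Her hω hG) (hn (hv ▸ hdeg v)))

theorem quadSum_le_quadSum {n : ℕ} (G : SimpleGraph (Fin n)) {x y : Fin n → ℝ}
    (h : ∀ u v, x u * x v ≤ y u * y v) : quadSum G x ≤ quadSum G y :=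
  Finset.sum_le_sum fun u _ => Finset.sum_le_sum fun v _ => by
    split_ifs
    exacts [h u v, le_rfl]

theorem quadSum_one_le {n : ℕ} (G : SimpleGraph (Fin n)) : quadSum G 1 ≤ (n : ℝ) ^ 2 := by
  calc quadSum G 1 ≤ ∑ _u : Fin n, ∑ _v : Fin n, (1 : ℝ) :=
        Finset.sum_le_sum fun u _ => Finset.sum_le_sum fun v _ => by split_ifs <;> simp
    _ = (n : ℝ) ^ 2 := by simp [sq]

open Classical in
theorem quadSum_one_succ {n : ℕ} (G : SimpleGraph (Fin (n + 1))) (a : Fin (n + 1)) :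
    quadSum G 1 = quadSum (G.comap a.succAboveEmb) 1 + 2 * G.degree a := by
  have hdeg : (G.degree a : ℝ) = ∑ i : Fin n, if G.Adj a (a.succAbove i) then (1 : ℝ) else 0 := by
    have : (G.degree a : ℝ) = ∑ v, if G.Adj a v then (1 : ℝ) else 0 := by
      rw [← SimpleGraph.card_neighborFinset_eq_degree, SimpleGraph.neighborFinset_eq_filter]
      simp
    rw [this, Fin.sum_univ_succAbove _ a]
    simp
  unfold quadSum
  rw [Fin.sum_univ_succAbove _ a]
  simp only [Fin.sum_univ_succAbove _ a, Finset.sum_add_distrib, hdeg]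
  simp [G.adj_comm _ a]
  ring

/-- The edge density of the graphs in `Her F` is at most `1 - 1 / (β(F) - 1) + o(1)`. -/
theorem exists_quadSum_one_le {F : GraphFamily} (hω : omegaLow F ≠ 0) {r : ℕ} (hr₁ : 1 ≤ r)
    (hr : betaF F = r + 1) {ε : ℝ} (hε : 0 < ε) :
    ∃ C : ℝ, 0 ≤ C ∧ ∀ (n : ℕ) (G : SimpleGraph (Fin n)), G ∈ Her F n →
      quadSum G 1 ≤ (1 - 1 / r + ε) * (n * (n + 1)) + C := by
  classical
  obtain ⟨N, hN⟩ := eventually_atTop.1 (eventually_exists_degree_lt hω hr hε)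
  have hc : 0 ≤ 1 - 1 / (r : ℝ) + ε := by
    have : 1 / (r : ℝ) ≤ 1 := by
      rw [div_le_one (by positivity)]
      exact_mod_cast hr₁
    linarith
  refine ⟨(N : ℝ) ^ 2, by positivity, fun n => ?_⟩
  induction n with
  | zero => intro G _; simp [quadSum]
  | succ n ih =>
    intro G hG
    rcases lt_or_ge (n + 1) N with h | h
    · have h1 := quadSum_one_le G
      have h2 : ((n + 1 : ℕ) : ℝ) ^ 2 ≤ (N : ℝ) ^ 2 := by gcongr
      have h3 : 0 ≤ (1 - 1 / (r : ℝ) + ε) * ((n + 1 : ℕ) * ((n + 1 : ℕ) + 1)) := by positivity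
      linarith
    · obtain ⟨v, hv⟩ := hN (n + 1) h G hG
      have h1 := ih _ (isHereditary_Her F v.succAboveEmb hG)
      rw [quadSum_one_succ G v]
      push_cast at hv ⊢
      simp only [Fin.coe_succAboveEmb] at h1
      linarith

open Classical in
theorem quadSum_add_smul_single_sub_single {n : ℕ} (G : SimpleGraph (Fin n)) (y : Fin n → ℝ)
    {u v : Fin n} (huv : ¬ G.Adj u v) (t : ℝ) :
    quadSum G (y + t • (Pi.single u 1 - Pi.single v 1)) =
      quadSum G y + 2 * t * ((∑ b, if G.Adj u b then y b else 0) -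
        ∑ b, if G.Adj v b then y b else 0) := by
  set δ : Fin n → ℝ := Pi.single u 1 - Pi.single v 1 with hδ
  have hsum : ∀ g : Fin n → ℝ, ∑ a, δ a * g a = g u - g v := fun g => by
    simp [hδ, sub_mul, Finset.sum_sub_distrib, Pi.single_apply]
  set A : Fin n → Fin n → ℝ := fun a b => if G.Adj a b then 1 else 0 with hA
  have hite : ∀ (a b : Fin n) (x : ℝ), (if G.Adj a b then x else 0) = A a b * x := fun a b x => by
    simp [hA]
  have hcomm : ∀ a b, A a b = A b a := fun a b => by simp [hA, G.adj_comm]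
  have h₁ : ∑ a, ∑ b, A a b * (δ a * y b) = ∑ b, A u b * y b - ∑ b, A v b * y b := by
    rw [← hsum fun a => ∑ b, A a b * y b]
    refine Finset.sum_congr rfl fun a _ => ?_
    rw [Finset.mul_sum]
    exact Finset.sum_congr rfl fun b _ => by ring
  have h₂ : ∑ a, ∑ b, A a b * (y a * δ b) = ∑ b, A u b * y b - ∑ b, A v b * y b := by
    rw [← h₁, Finset.sum_comm]
    refine Finset.sum_congr rfl fun a _ => Finset.sum_congr rfl fun b _ => ?_
    rw [hcomm]; ring
  have h₃ : ∑ a, ∑ b, A a b * (δ a * δ b) = 0 := by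
    have : ∑ a, ∑ b, A a b * (δ a * δ b) = ∑ a, δ a * ∑ b, δ b * A a b :=
      Finset.sum_congr rfl fun a _ => by
        rw [Finset.mul_sum]
        exact Finset.sum_congr rfl fun b _ => by ring
    simp only [this, hsum]
    simp [hA, huv, mt SimpleGraph.Adj.symm huv]
  simp only [quadSum, hite]
  calc ∑ a, ∑ b, A a b * ((y + t • δ) a * (y + t • δ) b)
      = ∑ a, ∑ b, (A a b * (y a * y b) + t * (A a b * (δ a * y b)) + t * (A a b * (y a * δ b))
          + t ^ 2 * (A a b * (δ a * δ b))) := by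
        refine Finset.sum_congr rfl fun a _ => Finset.sum_congr rfl fun b _ => ?_
        simp only [Pi.add_apply, Pi.smul_apply, smul_eq_mul]; ring
    _ = _ := by
        simp only [Finset.sum_add_distrib, ← Finset.mul_sum, h₁, h₂, h₃]
        ring

open Classical in
/-- Shifting weight between nonadjacent vertices in a suitable direction does not decrease
`quadSum`, so the vertices of fractional weight may be assumed to form a clique. -/
theorem exists_isClique_fractional_quadSum_le {n : ℕ} (G : SimpleGraph (Fin n)) (y : Fin n → ℝ)
    (hy : ∀ i, y i ∈ Set.Icc (0 : ℝ) 1) :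
    ∃ z : Fin n → ℝ, (∀ i, z i ∈ Set.Icc (0 : ℝ) 1) ∧ ∑ i, z i = ∑ i, y i ∧
      quadSum G y ≤ quadSum G z ∧ G.IsClique {i | z i ∈ Set.Ioo (0 : ℝ) 1} := by
  induction hk : (Finset.univ.filter fun i => y i ∈ Set.Ioo (0 : ℝ) 1).card
    using Nat.strong_induction_on generalizing y with
  | _ k ih =>
  by_cases hcl : G.IsClique {i | y i ∈ Set.Ioo (0 : ℝ) 1}
  · exact ⟨y, hy, rfl, le_rfl, hcl⟩
  rw [SimpleGraph.isClique_iff, Set.Pairwise] at hcl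
  push Not at hcl
  obtain ⟨u, v, hu, hv, hne, huv, hle⟩ : ∃ u v, y u ∈ Set.Ioo (0 : ℝ) 1 ∧ y v ∈ Set.Ioo (0 : ℝ) 1 ∧
      u ≠ v ∧ ¬ G.Adj u v ∧ (∑ b, if G.Adj v b then y b else 0) ≤
        ∑ b, if G.Adj u b then y b else 0 := by
    obtain ⟨u, hu, v, hv, hne, huv⟩ := hcl
    rcases le_total (∑ b, if G.Adj v b then y b else 0)
      (∑ b, if G.Adj u b then y b else 0) with h | h
    · exact ⟨u, v, hu, hv, hne, huv, h⟩
    · exact ⟨v, u, hv, hu, hne.symm, mt SimpleGraph.Adj.symm huv, h⟩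
  set t := min (1 - y u) (y v) with ht
  have ht₀ : 0 < t := lt_min (by linarith [hu.2]) hv.1
  have ht₁ : t ≤ 1 - y u := min_le_left _ _
  have ht₂ : t ≤ y v := min_le_right _ _
  set y' : Fin n → ℝ := y + t • (Pi.single u 1 - Pi.single v 1) with hy'
  have hyu : y' u = y u + t := by simp [hy', hne]
  have hyv : y' v = y v - t := by simp [hy', hne.symm]; ring
  have hyo : ∀ i, i ≠ u → i ≠ v → y' i = y i := fun i h₁ h₂ => by simp [hy', h₁, h₂]
  have hmem : ∀ i, y' i ∈ Set.Icc (0 : ℝ) 1 := by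
    intro i
    by_cases h₁ : i = u
    · subst h₁; rw [hyu]; constructor <;> linarith [hu.1]
    by_cases h₂ : i = v
    · subst h₂; rw [hyv]; constructor <;> linarith [hv.2]
    rw [hyo i h₁ h₂]; exact hy i
  have hlt : (Finset.univ.filter fun i => y' i ∈ Set.Ioo (0 : ℝ) 1).card < k := by
    rw [← hk]
    refine Finset.card_lt_card ⟨fun i hi => ?_, fun hsub => ?_⟩
    · simp only [Finset.mem_filter, Finset.mem_univ, true_and] at hi ⊢
      by_cases h₁ : i = u
      · exact h₁ ▸ hu
      by_cases h₂ : i = v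
      · exact h₂ ▸ hv
      rwa [hyo i h₁ h₂] at hi
    · have hu' := (Finset.mem_filter.1 (hsub (Finset.mem_filter.2 ⟨Finset.mem_univ u, hu⟩))).2
      have hv' := (Finset.mem_filter.1 (hsub (Finset.mem_filter.2 ⟨Finset.mem_univ v, hv⟩))).2
      rw [hyu] at hu'
      rw [hyv] at hv'
      rcases min_choice (1 - y u) (y v) with h | h
      · linarith [hu'.2]
      · linarith [hv'.1]
  obtain ⟨z, hz, hzs, hzq, hzc⟩ := ih _ hlt y' hmem rfl
  refine ⟨z, hz, ?_, ?_, hzc⟩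
  · rw [hzs, hy']
    simp [Finset.sum_add_distrib, ← Finset.mul_sum, Pi.single_apply]
  · refine le_trans ?_ hzq
    rw [hy', quadSum_add_smul_single_sub_single G y huv]
    have := mul_nonneg (mul_nonneg zero_le_two ht₀.le) (sub_nonneg.2 hle)
    linarith

open Classical in
/-- In a `K_a`-free graph, weights in `[0, 1]` are dominated by an induced subgraph of almost the same
total weight. -/
theorem exists_card_le_quadSum_le {n a : ℕ} {G : SimpleGraph (Fin n)} (hG : G.CliqueFree a)
    (y : Fin n → ℝ) (hy : ∀ i, y i ∈ Set.Icc (0 : ℝ) 1) :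
    ∃ (k : ℕ) (f : Fin k ↪ Fin n), (k : ℝ) ≤ ∑ i, y i + a ∧
      quadSum G y ≤ quadSum (G.comap f) 1 := by
  obtain ⟨z, hz, hzs, hzq, hzc⟩ :=
    exists_isClique_fractional_quadSum_le G y hy
  set T := Finset.univ.filter fun i => 0 < z i with hT
  refine ⟨T.card, (T.orderEmbOfFin rfl).toEmbedding, ?_, hzq.trans ?_⟩
  · set S := Finset.univ.filter fun i => z i ∈ Set.Ioo (0 : ℝ) 1 with hS
    have hSa : S.card ≤ a := by
      by_contra! h
      refine hG.mono h.le S ⟨?_, rfl⟩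
      simpa [hS] using hzc
    have hTS : (T.card : ℝ) ≤ ∑ i, z i + S.card := by
      have h1 : (T.card : ℝ) = ∑ i, if 0 < z i then (1 : ℝ) else 0 := by simp [hT]
      have h2 : (S.card : ℝ) = ∑ i, if z i ∈ Set.Ioo (0 : ℝ) 1 then (1 : ℝ) else 0 := by
        simp [hS]
      rw [h1, h2, ← Finset.sum_add_distrib]
      refine Finset.sum_le_sum fun i _ => ?_
      have := hz i
      simp only [Set.mem_Icc, Set.mem_Ioo] at this ⊢
      split_ifs with h3 h4 <;> grind
    rw [← hzs]
    have : (S.card : ℝ) ≤ a := by exact_mod_cast hSa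
    linarith
  · have hsum : ∀ g : Fin n → ℝ, ∑ j : Fin T.card, g (T.orderEmbOfFin rfl j) = ∑ i ∈ T, g i := by
      intro g
      rw [← Finset.sum_coe_sort T]
      exact Fintype.sum_equiv (T.orderIsoOfFin rfl).toEquiv _ _ fun j => rfl
    have h : quadSum (G.comap (T.orderEmbOfFin rfl).toEmbedding) 1 =
        ∑ u ∈ T, ∑ v ∈ T, if G.Adj u v then (1 : ℝ) else 0 := by
      rw [← hsum]
      refine Finset.sum_congr rfl fun i _ => ?_
      rw [← hsum]
      exact Finset.sum_congr rfl fun j _ => by simp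
    rw [h, hT, Finset.sum_filter]
    refine Finset.sum_le_sum fun u _ => ?_
    rw [Finset.sum_filter]
    have hpos : ∀ i, ¬ 0 < z i → z i = 0 := fun i hi => le_antisymm (not_lt.1 hi) (hz i).1
    split_ifs with hu
    · refine Finset.sum_le_sum fun v _ => ?_
      split_ifs with h1 h2 h2
      · exact mul_le_one₀ (hz u).2 (hz v).1 (hz v).2
      · simp [hpos v h2]
      · exact le_rfl
      · exact le_rfl
    · simp [hpos u hu]

theorem quadSum_smul {n : ℕ} (G : SimpleGraph (Fin n)) (s : ℝ) (x : Fin n → ℝ) :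
    quadSum G (s • x) = s ^ 2 * quadSum G x := by
  simp only [quadSum, Finset.mul_sum, mul_ite, mul_zero, Pi.smul_apply, smul_eq_mul]
  refine Finset.sum_congr rfl fun u _ => Finset.sum_congr rfl fun v _ => ?_
  split_ifs
  · ring
  · rfl

theorem quadSum_le_add_sum_sub {n : ℕ} (G : SimpleGraph (Fin n)) {x y : Fin n → ℝ}
    (hx : ∀ i, 0 ≤ x i) (hxy : ∀ i, x i ≤ y i) :
    quadSum G y ≤ quadSum G x + 2 * (∑ i, y i) * ∑ i, (y i - x i) := by
  have h : 2 * (∑ i, y i) * ∑ i, (y i - x i) =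
      ∑ u, ∑ v, (y u * (y v - x v) + (y u - x u) * y v) := by
    simp only [Finset.sum_add_distrib, ← Finset.mul_sum, ← Finset.sum_mul]
    ring
  rw [h]
  simp only [quadSum, ← Finset.sum_add_distrib]
  refine Finset.sum_le_sum fun u _ => Finset.sum_le_sum fun v _ => ?_
  have h₁ := hx u
  have h₂ := hx v
  have h₃ := hxy u
  have h₄ := hxy v
  split_ifs <;> nlinarith [mul_nonneg (sub_nonneg.2 h₃) (sub_nonneg.2 h₄),
    mul_nonneg h₁ (sub_nonneg.2 h₄), mul_nonneg (sub_nonneg.2 h₃) h₂]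

/-- Truncating the weights at `M` bounds `quadSum` through the edge density of induced subgraphs. -/
theorem quadSum_le_of_sum_rpow {α : ℝ} (hα : 1 < α) {n a : ℕ} {G : SimpleGraph (Fin n)}
    (hG : G.CliqueFree a) {c C M : ℝ} (hc : 0 ≤ c) (hM : 0 < M)
    (hd : ∀ (k : ℕ) (f : Fin k ↪ Fin n), quadSum (G.comap f) 1 ≤ c * (k * (k + 1)) + C)
    {y : Fin n → ℝ} (hy : ∀ i, 0 ≤ y i) (hsum : ∑ i, y i ^ α = n) :
    quadSum G y ≤ c * (n + (a + 1) * M) ^ 2 + C * M ^ 2 + 2 * M ^ (1 - α) * n ^ 2 := by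
  have hys : ∑ i, y i ≤ n := by
    have h : ∑ i, (1 + α * (y i - 1)) ≤ ∑ i, y i ^ α := Finset.sum_le_sum fun i _ => by
      simpa using one_add_mul_self_le_rpow_one_add (s := y i - 1) (by linarith [hy i]) hα.le
    rw [hsum] at h
    simp only [Finset.sum_add_distrib, ← Finset.mul_sum, Finset.sum_sub_distrib] at h
    simp at h
    nlinarith
  have htrunc : ∀ i, y i - min (y i) M ≤ M ^ (1 - α) * y i ^ α := by
    intro i
    rcases le_total (y i) M with h | h
    · rw [min_eq_left h, sub_self]
      have := hy i
      positivity
    · have hpos : 0 < y i := hM.trans_le h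
      calc y i - min (y i) M ≤ y i := by rw [min_eq_right h]; linarith
        _ = y i ^ (1 - α) * y i ^ α := by rw [← Real.rpow_add hpos]; simp
        _ ≤ M ^ (1 - α) * y i ^ α := by
          gcongr ?_ * _
          exact Real.rpow_le_rpow_of_nonpos hM h (by linarith)
  have htail : ∑ i, (y i - min (y i) M) ≤ M ^ (1 - α) * n := by
    rw [← hsum, Finset.mul_sum]
    exact Finset.sum_le_sum fun i _ => htrunc i
  have hmin : ∀ i, 0 ≤ min (y i) M := fun i => le_min (hy i) hM.le
  obtain ⟨k, f, hk, hq⟩ := exists_card_le_quadSum_le hG (M⁻¹ • fun i => min (y i) M) fun i => by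
    refine ⟨mul_nonneg (by positivity) (hmin i), ?_⟩
    calc M⁻¹ * min (y i) M ≤ M⁻¹ * M := by gcongr; exact min_le_right _ _
      _ = 1 := inv_mul_cancel₀ hM.ne'
  have hkM : (k + 1) * M ≤ n + (a + 1) * M := by
    have h₁ : ∑ i, (M⁻¹ • fun i => min (y i) M) i ≤ M⁻¹ * n := by
      simp only [Pi.smul_apply, smul_eq_mul, ← Finset.mul_sum]
      gcongr
      exact (Finset.sum_le_sum fun i _ => min_le_left _ _).trans hys
    have h₂ : (k : ℝ) ≤ M⁻¹ * n + a := by linarith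
    have h₃ : M⁻¹ * n * M = n := by field_simp
    nlinarith
  have hmain : quadSum G (fun i => min (y i) M) ≤ c * (n + (a + 1) * M) ^ 2 + C * M ^ 2 := by
    have h₁ := hq.trans (hd k f)
    rw [quadSum_smul] at h₁
    have h₂ : quadSum G (fun i => min (y i) M) ≤ M ^ 2 * (c * (k * (k + 1)) + C) := by
      have := mul_le_mul_of_nonneg_left h₁ (sq_nonneg M)
      rwa [← mul_assoc, ← mul_pow, mul_inv_cancel₀ hM.ne', one_pow, one_mul] at this
    have h₃ : ((k : ℝ) * (k + 1)) * M ^ 2 ≤ (n + (a + 1) * M) ^ 2 := by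
      calc ((k : ℝ) * (k + 1)) * M ^ 2 ≤ ((k + 1) * M) ^ 2 := by
            rw [mul_pow]; gcongr; nlinarith [Nat.cast_nonneg (α := ℝ) k]
        _ ≤ _ := by gcongr
    nlinarith [mul_le_mul_of_nonneg_left h₃ hc]
  have hle := quadSum_le_add_sum_sub G hmin fun i => min_le_left (y i) M
  have hD : 2 * (∑ i, y i) * ∑ i, (y i - min (y i) M) ≤ 2 * n * (M ^ (1 - α) * n) := by
    gcongr
    exact Finset.sum_nonneg fun i _ => sub_nonneg.2 (min_le_left _ _)
  nlinarith

theorem lambdaA_mul_rpow_le {α : ℝ} (hα : 1 < α) {n : ℕ} (hn : 0 < n) {G : SimpleGraph (Fin n)}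
    {B : ℝ} (hB₀ : 0 ≤ B)
    (hB : ∀ y : Fin n → ℝ, (∀ i, 0 ≤ y i) → ∑ i, y i ^ α = n → quadSum G y ≤ B) :
    lambdaA α G ≤ B / (n : ℝ) ^ (2 / α) := by
  have hn' : (0 : ℝ) < n := by exact_mod_cast hn
  refine Real.sSup_le ?_ (by positivity)
  rintro _ ⟨x, hx, rfl⟩
  set y : Fin n → ℝ := ((n : ℝ) ^ (1 / α)) • fun i => |x i| with hy
  have hsum : ∑ i, y i ^ α = n := by
    have : ∀ i, y i ^ α = n * |x i| ^ α := fun i => by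
      rw [hy, Pi.smul_apply, smul_eq_mul, Real.mul_rpow (by positivity) (abs_nonneg _),
        ← Real.rpow_mul hn'.le, one_div_mul_cancel (by linarith), Real.rpow_one]
    simp only [this, ← Finset.mul_sum, hx, mul_one]
  have h := hB y (fun i => by simp only [hy, Pi.smul_apply, smul_eq_mul]; positivity) hsum
  rw [hy, quadSum_smul, ← Real.rpow_mul_natCast hn'.le] at h
  rw [le_div_iff₀' (by positivity)]
  refine le_trans ?_ h
  rw [show 1 / α * (2 : ℕ) = 2 / α by push_cast; ring]
  gcongr
  exact quadSum_le_quadSum G fun u v => by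
    rw [← abs_mul]; exact le_abs_self _

theorem eventually_lambdaP_mul_rpow_le {α : ℝ} (hα : 1 < α) {F : GraphFamily}
    (hω : omegaLow F ≠ 0) {r : ℕ} (hr₁ : 1 ≤ r) (hr : betaF F = r + 1) {b : ℝ}
    (hb : 1 - 1 / (r : ℝ) < b) :
    ∀ᶠ n : ℕ in atTop, lambdaP α (Her F) n * (n : ℝ) ^ (2 / α - 2) < b := by
  set ε : ℝ := (b - (1 - 1 / r)) / 4 with hε
  have hε₀ : 0 < ε := by rw [hε]; linarith
  obtain ⟨C, hC₀, hC⟩ := exists_quadSum_one_le hω hr₁ hr hε₀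
  set c := 1 - 1 / (r : ℝ) + ε with hc
  have hc₀ : 0 ≤ c := by
    have : 1 / (r : ℝ) ≤ 1 := by
      rw [div_le_one (by positivity)]
      exact_mod_cast hr₁
    linarith
  obtain ⟨M, hMε, hM⟩ : ∃ M : ℝ, M ^ (1 - α) < ε ∧ 0 < M := by
    have h := tendsto_rpow_neg_atTop (y := α - 1) (by linarith)
    simp only [neg_sub] at h
    exact ((h.eventually_lt_const hε₀).and (eventually_gt_atTop 0)).exists
  set a := omegaLow F
  have hlim : Tendsto (fun n : ℕ => c * (1 + ((a + 1) * M) / (n : ℝ)) ^ 2 + C * (M / (n : ℝ)) ^ 2 +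
      2 * M ^ (1 - α)) atTop (nhds (c * (1 + 0) ^ 2 + C * 0 ^ 2 + 2 * M ^ (1 - α))) :=
    (((tendsto_const_nhds.add (tendsto_const_div_atTop_nhds_zero_nat _)).pow 2).const_mul c).add
      (((tendsto_const_div_atTop_nhds_zero_nat M).pow 2).const_mul C) |>.add tendsto_const_nhds
  have hlt : c * (1 + 0) ^ 2 + C * 0 ^ 2 + 2 * M ^ (1 - α) < b := by
    norm_num
    linarith
  filter_upwards [hlim.eventually_lt_const hlt, eventually_gt_atTop 0] with n hn hn₀
  have hn' : (0 : ℝ) < n := by exact_mod_cast hn₀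
  refine lt_of_le_of_lt ?_ hn
  set B : ℝ := c * (n + (a + 1) * M) ^ 2 + C * M ^ 2 + 2 * M ^ (1 - α) * n ^ 2 with hB
  have hB₀ : 0 ≤ B := by positivity
  have hP : lambdaP α (Her F) n ≤ B / (n : ℝ) ^ (2 / α) := by
    refine Real.sSup_le ?_ (by positivity)
    rintro _ ⟨G, hG, rfl⟩
    exact lambdaA_mul_rpow_le hα hn₀ hB₀ fun y hy hsum =>
      quadSum_le_of_sum_rpow hα (cliqueFree_of_mem_Her hω hG) hc₀ hM
        (fun k f => hC k _ (isHereditary_Her F f hG)) hy hsum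
  calc lambdaP α (Her F) n * (n : ℝ) ^ (2 / α - 2)
      ≤ B / (n : ℝ) ^ (2 / α) * (n : ℝ) ^ (2 / α - 2) := by gcongr
    _ = B / (n : ℝ) ^ 2 := by
      rw [Real.rpow_sub hn', Real.rpow_two]
      have : (n : ℝ) ^ (2 / α) ≠ 0 := by positivity
      field_simp
    _ = _ := by rw [hB]; field_simp

theorem quadSum_le_sq {α : ℝ} (hα : 0 < α) {n : ℕ} {x : Fin n → ℝ} (G : SimpleGraph (Fin n))
    (hx : ∑ i, |x i| ^ α = 1) : quadSum G x ≤ (n : ℝ) ^ 2 := by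
  have h : ∀ i, |x i| ≤ 1 := fun i => by
    have h₁ : |x i| ^ α ≤ 1 := hx ▸ Finset.single_le_sum (f := fun i => |x i| ^ α)
      (fun i _ => by positivity) (Finset.mem_univ i)
    by_contra! h₂
    exact absurd h₁ (not_le.2 (Real.one_lt_rpow h₂ hα))
  refine le_trans (quadSum_le_quadSum G fun u v => ?_) (quadSum_one_le G)
  calc x u * x v ≤ |x u| * |x v| := by rw [← abs_mul]; exact le_abs_self _
    _ ≤ 1 * 1 := by gcongr <;> exact h _

theorem quadSum_le_lambdaP {α : ℝ} (hα : 0 < α) {P : GraphFamily} {n : ℕ} {G : SimpleGraph (Fin n)}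
    (hG : G ∈ P n) {x : Fin n → ℝ} (hx : ∑ i, |x i| ^ α = 1) :
    quadSum G x ≤ lambdaP α P n := by
  have h₁ : quadSum G x ≤ lambdaA α G := by
    refine le_csSup ⟨(n : ℝ) ^ 2, ?_⟩ ⟨x, hx, rfl⟩
    rintro _ ⟨y, hy, rfl⟩
    exact quadSum_le_sq hα G hy
  refine h₁.trans (le_csSup ⟨(n : ℝ) ^ 2, ?_⟩ ⟨G, hG, rfl⟩)
  rintro _ ⟨H, -, rfl⟩
  refine Real.sSup_le ?_ (by positivity)
  rintro _ ⟨y, hy, rfl⟩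
  exact quadSum_le_sq hα H hy

theorem turanGraph_mem_Her {F : GraphFamily} {r : ℕ} (hr₁ : 0 < r) (hr : r < betaF F) (n : ℕ) :
    SimpleGraph.turanGraph n r ∈ Her F n := by
  classical
  rintro m hm H hH ⟨f, hf⟩
  let c : Fin m → Fin r := fun u => ⟨f u % r, Nat.mod_lt _ hr₁⟩
  let T := Finset.univ.image c
  have hT : ∀ u, c u ∈ T := fun u => Finset.mem_image_of_mem _ (Finset.mem_univ u)
  have hle : betaF F ≤ T.card := by
    refine Nat.sInf_le ⟨Finset.card_pos.2 ⟨_, hT ⟨0, hm⟩⟩, m, H, hH,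
      fun u => T.equivFin ⟨c u, hT u⟩, fun j => ?_, fun u v => ?_⟩
    · obtain ⟨u, -, hu⟩ := Finset.mem_image.1 (T.equivFin.symm j).2
      exact ⟨u, by simp [hu]⟩
    · rw [← hf, SimpleGraph.turanGraph_adj, ne_eq, ne_eq, T.equivFin.injective.eq_iff]
      simp [c]
  have hTr : T.card ≤ r := by simpa using T.card_le_univ
  omega

theorem le_quadSum_turanGraph (r n : ℕ) :
    (1 - 1 / (r : ℝ)) * n ^ 2 - n ≤ quadSum (SimpleGraph.turanGraph n r) 1 := by
  classical
  have hrow : ∀ u : Fin n, (n : ℝ) - (n / r + 1) ≤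
      ∑ v, if (SimpleGraph.turanGraph n r).Adj u v then (1 : Fin n → ℝ) u * (1 : Fin n → ℝ) v
        else 0 := by
    intro u
    have h₁ : ((Finset.univ.filter fun v : Fin n => v.1 % r = u.1 % r).card : ℝ) ≤ n / r + 1 := by
      have h₂ : (Finset.univ.filter fun v : Fin n => v.1 % r = u.1 % r).card ≤ n / r + 1 := by
        rw [← Finset.card_range (n / r + 1)]
        refine Finset.card_le_card_of_injOn (fun v => v.1 / r) (fun v _ => ?_)
          fun v hv w hw hvw => ?_
        · simpa [Nat.lt_succ_iff] using Nat.div_le_div_right v.2.le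
        · simp only [Finset.coe_filter, Finset.mem_univ, true_and, Set.mem_ofPred_eq] at hv hw hvw
          rw [Fin.ext_iff, ← Nat.div_add_mod v.1 r, ← Nat.div_add_mod w.1 r, hvw, hv, hw]
      calc _ ≤ ((n / r + 1 : ℕ) : ℝ) := by exact_mod_cast h₂
        _ ≤ n / r + 1 := by push_cast; gcongr; exact Nat.cast_div_le
    have h₃ := Finset.card_filter_add_card_filter_not (s := (Finset.univ : Finset (Fin n)))
      (fun v => v.1 % r = u.1 % r)
    rw [Finset.card_univ, Fintype.card_fin] at h₃
    have h₄ : ((Finset.univ.filter fun v : Fin n => v.1 % r = u.1 % r).card : ℝ) +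
      (Finset.univ.filter fun v : Fin n => ¬ v.1 % r = u.1 % r).card = n := by exact_mod_cast h₃
    simp only [SimpleGraph.turanGraph_adj, Pi.one_apply, mul_one, Finset.sum_boole]
    simp only [ne_comm (a := u.1 % r), ne_eq]
    linarith
  calc (1 - 1 / (r : ℝ)) * n ^ 2 - n = ∑ _u : Fin n, ((n : ℝ) - (n / r + 1)) := by
        simp; ring
    _ ≤ _ := Finset.sum_le_sum fun u _ => (hrow u).trans_eq (Finset.sum_congr rfl fun v _ => by congr)

theorem le_lambdaP_mul_rpow {α : ℝ} (hα : 0 < α) {F : GraphFamily} {r : ℕ} (hr₁ : 0 < r)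
    (hr : r < betaF F) {n : ℕ} (hn : 0 < n) :
    1 - 1 / (r : ℝ) - 1 / n ≤ lambdaP α (Her F) n * (n : ℝ) ^ (2 / α - 2) := by
  have hn' : (0 : ℝ) < n := by exact_mod_cast hn
  have hx : ∑ i : Fin n, |(((n : ℝ) ^ (-(1 / α))) • (1 : Fin n → ℝ)) i| ^ α = 1 := by
    have : ∀ i : Fin n, |(((n : ℝ) ^ (-(1 / α))) • (1 : Fin n → ℝ)) i| ^ α = (n : ℝ)⁻¹ := fun i => by
      rw [Pi.smul_apply, Pi.one_apply, smul_eq_mul, mul_one, abs_of_pos (by positivity),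
        ← Real.rpow_mul hn'.le, neg_mul, one_div_mul_cancel hα.ne', Real.rpow_neg_one]
    simp only [this, Finset.sum_const, Finset.card_univ, Fintype.card_fin, nsmul_eq_mul]
    exact mul_inv_cancel₀ hn'.ne'
  have h := quadSum_le_lambdaP hα (turanGraph_mem_Her hr₁ hr n) hx
  rw [quadSum_smul, ← Real.rpow_mul_natCast hn'.le] at h
  have hT := le_quadSum_turanGraph r n
  calc 1 - 1 / (r : ℝ) - 1 / n = ((1 - 1 / (r : ℝ)) * n ^ 2 - n) / n ^ 2 := by field_simp
    _ ≤ quadSum (SimpleGraph.turanGraph n r) 1 / n ^ 2 := by gcongr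
    _ = (n : ℝ) ^ (-(1 / α) * (2 : ℕ)) * quadSum (SimpleGraph.turanGraph n r) 1 *
        (n : ℝ) ^ (2 / α - 2) := by
      rw [mul_right_comm, ← Real.rpow_add hn',
        show -(1 / α) * (2 : ℕ) + (2 / α - 2) = -(2 : ℕ) by push_cast; ring,
        Real.rpow_neg hn'.le, Real.rpow_natCast]
      field_simp
    _ ≤ _ := by gcongr

/-- For `α > 1`, if `ω̲(F) ≥ 2`, `β(F) ≥ 2` and `P = Her F` is infinite,
then `λ^(α)(P) = lim_{n→∞} λ^(α)(P,n) ⬝ n^{2/α−2} = 1 − 1/(β(F) − 1)`. -/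
theorem lambdaP_lim_eq_of_beta (α : ℝ) (hα : 1 < α) (F : GraphFamily)
    (hω : 2 ≤ omegaLow F) (hβ : 2 ≤ betaF F) (hinf : FamInfinite (Her F)) :
    Tendsto (fun n : ℕ => lambdaP α (Her F) n * (n : ℝ) ^ (2 / α - 2)) atTop
      (nhds (1 - 1 / ((betaF F : ℝ) - 1))) := by
  obtain ⟨r, hr⟩ : ∃ r, betaF F = r + 1 := ⟨betaF F - 1, by omega⟩
  have hr₁ : 1 ≤ r := by omega
  rw [show (betaF F : ℝ) - 1 = r by rw [hr]; push_cast; ring]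
  rw [tendsto_order]
  refine ⟨fun b hb => ?_, fun b hb =>
    eventually_lambdaP_mul_rpow_le hα (by omega) hr₁ hr hb⟩
  have hlim : Tendsto (fun n : ℕ => 1 - 1 / (r : ℝ) - 1 / (n : ℝ)) atTop
      (nhds (1 - 1 / (r : ℝ) - 0)) :=
    tendsto_const_nhds.sub (tendsto_const_div_atTop_nhds_zero_nat 1)
  rw [sub_zero] at hlim
  filter_upwards [hlim.eventually_const_lt hb, eventually_gt_atTop 0] with n hn hn₀
  exact hn.trans_le (le_lambdaP_mul_rpow (by linarith) hr₁ (by omega) hn₀)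
end
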